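/- Let ω > 0, z ∈ ℬ_ω, let φ_σ = φ̂_σ and φ_ρ = φ̂_ρ be hat kernels with 0 < σ ≤ ρ ≤ ω/2, set f_σ = φ̂_σ * z, and let λ > 0 satisfy 2/λ + (1/(15ρ²))(−σ³ + 5ρσ² + 17ρ³) < ω. If u is a minimiser of F₃(u) = ∫_ℝ|u′| + λ‖φ̂_ρ*u − f_σ‖²_{L²(ℝ)} over ℬ, then every interface location of u is an interface location of z. -/

import Mathlib

open MeasureTheory Set

noncomputable section

/-- The total variation `∫_ℝ |u'|` of a function `u : ℝ → ℝ`. -/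
def TV (u : ℝ → ℝ) : ENNReal := eVariationOn u Set.univ

/-- Convolution `(φ * u)(x) = ∫_ℝ φ(x − y) u(y) dy`. -/
def conv (φ u : ℝ → ℝ) : ℝ → ℝ := fun x => ∫ y : ℝ, φ (x - y) * u y

/-- Membership of `φ` in the kernel class `𝒦`, with parameter `σ` and profile `p`:
`φ(x) = p(|x|) χ_{[−σ,σ]}(x)` with `p ≥ 0` monotonically decreasing on `[0,σ]`
and `∫₀^σ p = 1/2`; in particular `φ ∈ L¹(ℝ)`. -/
def IsKernelWith (φ : ℝ → ℝ) (p : ℝ → ℝ) (σ : ℝ) : Prop :=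
  0 < σ ∧ Integrable φ ∧
    (∀ x ∈ Icc (0:ℝ) σ, 0 ≤ p x) ∧ AntitoneOn p (Icc (0:ℝ) σ) ∧
    (∫ x in (0:ℝ)..σ, p x) = 1 / 2 ∧
    ∀ x : ℝ, φ x = if |x| ≤ σ then p |x| else 0

/-- The hat kernel `φ̂_σ(x) = (1 − |x|/σ)/σ` for `|x| < σ`, `0` otherwise. -/
def hatKernel (σ : ℝ) : ℝ → ℝ := fun x => if |x| < σ then (1 - |x| / σ) / σ else 0

/-- The dual norm `‖f‖_* = sup { |∫ f v| : v ∈ L¹(ℝ), ∫_ℝ |v'| ≤ 1 }`. -/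
def starNorm (f : ℝ → ℝ) : ENNReal :=
  ⨆ (v : ℝ → ℝ) (_ : Integrable v ∧ TV v ≤ 1), ENNReal.ofReal |∫ x : ℝ, f x * v x|

/-- Structural description of a bar code: `n` bars with interface points
`t 0 < t 1 < ⋯ < t (2n−1)` inside `[0,1]`; the bars are the intervals
`[t (2k), t (2k+1)]`, `k < n`. -/
structure BarcodeRep where
  n : ℕ
  t : ℕ → ℝ
  mono : StrictMonoOn t (Set.Iio (2 * n))
  left : n ≠ 0 → 0 ≤ t 0
  right : n ≠ 0 → t (2 * n - 1) ≤ 1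

/-- The support of a bar code: the union of its (closed) bars. -/
def BarcodeRep.supp (B : BarcodeRep) : Set ℝ :=
  ⋃ k ∈ Finset.range B.n, Icc (B.t (2 * k)) (B.t (2 * k + 1))

/-- The bar code as a function: the characteristic function of the union of its bars. -/
def BarcodeRep.fn (B : BarcodeRep) : ℝ → ℝ := B.supp.indicator fun _ => (1:ℝ)

/-- `x` is an interface location (an endpoint of a bar) of the bar code `B`. -/
def BarcodeRep.IsInterface (B : BarcodeRep) (x : ℝ) : Prop := ∃ k < 2 * B.n, B.t k = x

/-- All bars and all (maximal, nonempty) spaces in `[0,1]` of the bar code `B`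
have width at least `ω`. -/
def BarcodeRep.MinWidth (B : BarcodeRep) (ω : ℝ) : Prop :=
  (∀ k < B.n, ω ≤ B.t (2 * k + 1) - B.t (2 * k)) ∧
  (∀ k, k + 1 < B.n → ω ≤ B.t (2 * k + 2) - B.t (2 * k + 1)) ∧
  (B.n ≠ 0 → 0 < B.t 0 → ω ≤ B.t 0) ∧
  (B.n ≠ 0 → B.t (2 * B.n - 1) < 1 → ω ≤ 1 - B.t (2 * B.n - 1))

/-- Membership in `ℬ`: `u` is (the standard representative of) a bar code. -/
def IsBarcode (u : ℝ → ℝ) : Prop := ∃ B : BarcodeRep, u = B.fn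

/-- Membership in `ℬ_ω`. -/
def IsBarcodeW (u : ℝ → ℝ) (ω : ℝ) : Prop := ∃ B : BarcodeRep, u = B.fn ∧ B.MinWidth ω

/-- Membership in `ℬ^{ij}`: `u = i` on `[0,x₁]` and `u = j` on `[x₂,1]` for some
`0 < x₁ ≤ x₂ < 1`. -/
def InBij (u : ℝ → ℝ) (i j : ℝ) : Prop :=
  ∃ x₁ x₂ : ℝ, 0 < x₁ ∧ x₁ ≤ x₂ ∧ x₂ < 1 ∧
    (∀ x ∈ Icc (0:ℝ) x₁, u x = i) ∧ (∀ x ∈ Icc x₂ (1:ℝ), u x = j)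

/-- The `L²` fidelity term `‖g − f‖²_{L²(ℝ)}`, valued in `[0,∞]`
(equal to `∞` if `g − f ∉ L²(ℝ)`). -/
def fidelity (g f : ℝ → ℝ) : ENNReal := ∫⁻ x : ℝ, ENNReal.ofReal ((g x - f x) ^ 2)

/-- The functional `F₁(u) = ∫_ℝ |u'| + λ ‖u − f‖²_{L²(ℝ)}`. -/
def F1 (lam : ℝ) (f u : ℝ → ℝ) : ENNReal := TV u + ENNReal.ofReal lam * fidelity u f

/-- The (blind) deconvolution functional `F(u) = ∫_ℝ |u'| + λ ‖φ*u − f‖²_{L²(ℝ)}`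
(this is `F₂` when `φ = φ_σ` and `F₃` when `φ = φ_ρ`). -/
def Fker (lam : ℝ) (φ f u : ℝ → ℝ) : ENNReal :=
  TV u + ENNReal.ofReal lam * fidelity (conv φ u) f


/-! ### Combinatorics of bar codes -/

lemma BarcodeRep.lt_of {B : BarcodeRep} {i j : ℕ} (hij : i < j) (hj : j < 2 * B.n) :
    B.t i < B.t j :=
  B.mono (by simp; omega) (by simpa using hj) hij

lemma BarcodeRep.le_of {B : BarcodeRep} {i j : ℕ} (hij : i ≤ j) (hj : j < 2 * B.n) :
    B.t i ≤ B.t j := by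
  rcases hij.lt_or_eq with h | h
  · exact (BarcodeRep.lt_of h hj).le
  · rw [h]

lemma BarcodeRep.mem_supp {B : BarcodeRep} {x : ℝ} :
    x ∈ B.supp ↔ ∃ k < B.n, B.t (2 * k) ≤ x ∧ x ≤ B.t (2 * k + 1) := by
  simp only [BarcodeRep.supp, mem_iUnion, Finset.mem_range, mem_Icc, exists_prop]

lemma BarcodeRep.fn_of_mem {B : BarcodeRep} {x : ℝ} (h : x ∈ B.supp) : B.fn x = 1 := by
  simp [BarcodeRep.fn, h]

lemma BarcodeRep.fn_of_not_mem {B : BarcodeRep} {x : ℝ} (h : x ∉ B.supp) : B.fn x = 0 := by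
  simp [BarcodeRep.fn, h]

lemma BarcodeRep.t_mem {B : BarcodeRep} {k : ℕ} (hk : k < 2 * B.n) : B.t k ∈ Icc (0:ℝ) 1 := by
  have hn : B.n ≠ 0 := by omega
  exact ⟨(B.left hn).trans (BarcodeRep.le_of (Nat.zero_le k) hk),
    (BarcodeRep.le_of (by omega) (by omega)).trans (B.right hn)⟩

lemma BarcodeRep.supp_subset (B : BarcodeRep) : B.supp ⊆ Icc (0:ℝ) 1 := by
  intro x hx
  obtain ⟨k, hk, h1, h2⟩ := BarcodeRep.mem_supp.1 hx
  exact ⟨(BarcodeRep.t_mem (by omega)).1.trans h1, h2.trans (BarcodeRep.t_mem (by omega)).2⟩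

lemma BarcodeRep.fn_gap {B : BarcodeRep} {k : ℕ} (hk : k + 1 < 2 * B.n) {x : ℝ}
    (h1 : B.t k < x) (h2 : x < B.t (k + 1)) : B.fn x = if Even k then 1 else 0 := by
  split_ifs with he
  · obtain ⟨j, rfl⟩ := he
    apply BarcodeRep.fn_of_mem
    rw [BarcodeRep.mem_supp]
    refine ⟨j, by omega, ?_, ?_⟩
    · rw [two_mul]; exact h1.le
    · rw [two_mul]; exact h2.le
  · rw [Nat.not_even_iff_odd] at he
    obtain ⟨j, rfl⟩ := he
    apply BarcodeRep.fn_of_not_mem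
    rw [BarcodeRep.mem_supp]
    rintro ⟨i, hi, h3, h4⟩
    rcases le_or_gt i j with hij | hij
    · have := BarcodeRep.le_of (B := B) (i := 2 * i + 1) (j := 2 * j + 1) (by omega) (by omega)
      linarith
    · have := BarcodeRep.le_of (B := B) (i := 2 * j + 1 + 1) (j := 2 * i) (by omega) (by omega)
      linarith

lemma BarcodeRep.fn_left {B : BarcodeRep} {x : ℝ} (h1 : x < B.t 0) : B.fn x = 0 := by
  apply BarcodeRep.fn_of_not_mem
  rw [BarcodeRep.mem_supp]
  rintro ⟨i, hi, h3, h4⟩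
  have := BarcodeRep.le_of (B := B) (i := 0) (j := 2 * i) (by omega) (by omega)
  linarith

lemma BarcodeRep.fn_right {B : BarcodeRep} {x : ℝ} (h1 : B.t (2 * B.n - 1) < x) : B.fn x = 0 := by
  apply BarcodeRep.fn_of_not_mem
  rw [BarcodeRep.mem_supp]
  rintro ⟨i, hi, h3, h4⟩
  have := BarcodeRep.le_of (B := B) (i := 2 * i + 1) (j := 2 * B.n - 1) (by omega) (by omega)
  linarith

lemma BarcodeRep.fn_zero_of_not_mem {B : BarcodeRep} {x : ℝ} (h : x ∉ Icc (0:ℝ) 1) :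
    B.fn x = 0 :=
  BarcodeRep.fn_of_not_mem fun h' => h (B.supp_subset h')

lemma BarcodeRep.fn_cases (B : BarcodeRep) (x : ℝ) : B.fn x = 0 ∨ B.fn x = 1 := by
  by_cases h : x ∈ B.supp
  · exact Or.inr (BarcodeRep.fn_of_mem h)
  · exact Or.inl (BarcodeRep.fn_of_not_mem h)

lemma BarcodeRep.fn_nonneg (B : BarcodeRep) (x : ℝ) : 0 ≤ B.fn x := by
  rcases B.fn_cases x with h | h <;> simp [h]

lemma BarcodeRep.fn_le_one (B : BarcodeRep) (x : ℝ) : B.fn x ≤ 1 := by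
  rcases B.fn_cases x with h | h <;> simp [h]

/-- the bar code as a sum of indicator functions -/
lemma BarcodeRep.fn_eq_sum (B : BarcodeRep) (x : ℝ) :
    B.fn x = ∑ k ∈ Finset.range B.n,
      (Icc (B.t (2 * k)) (B.t (2 * k + 1))).indicator (fun _ => (1:ℝ)) x := by
  by_cases h : x ∈ B.supp
  · rw [BarcodeRep.fn_of_mem h]
    obtain ⟨k, hk, h1, h2⟩ := BarcodeRep.mem_supp.1 h
    rw [Finset.sum_eq_single k]
    · simp [h1, h2]
    · intro i hi hik
      have hi' : i < B.n := by simpa using hi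
      rw [Set.indicator_of_notMem]
      rintro ⟨h3, h4⟩
      rcases lt_or_gt_of_ne hik with hlt | hlt
      · have := BarcodeRep.lt_of (B := B) (i := 2 * i + 1) (j := 2 * k) (by omega) (by omega)
        linarith
      · have := BarcodeRep.lt_of (B := B) (i := 2 * k + 1) (j := 2 * i) (by omega) (by omega)
        linarith
    · intro h; simp at h; omega
  · rw [BarcodeRep.fn_of_not_mem h]
    symm
    apply Finset.sum_eq_zero
    intro i hi
    rw [Set.indicator_of_notMem]
    intro hx
    exact h (BarcodeRep.mem_supp.2 ⟨i, by simpa using hi, hx.1, hx.2⟩)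

/-- upper bound on the total variation -/
lemma BarcodeRep.TV_le (B : BarcodeRep) : TV B.fn ≤ ((2 * B.n : ℕ) : ENNReal) := by
  classical
  let M : ℝ → ℝ := fun x => ∑ k ∈ Finset.range B.n,
    ((if B.t (2 * k) ≤ x then (1:ℝ) else 0) + (if B.t (2 * k + 1) < x then (1:ℝ) else 0))
  have hfn : ∀ x, B.fn x = ∑ k ∈ Finset.range B.n,
    ((if B.t (2 * k) ≤ x then (1:ℝ) else 0) - (if B.t (2 * k + 1) < x then (1:ℝ) else 0)) := by
    intro x
    rw [BarcodeRep.fn_eq_sum]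
    apply Finset.sum_congr rfl
    intro k hk
    have hk' : k < B.n := by simpa using hk
    have := BarcodeRep.lt_of (B := B) (i := 2 * k) (j := 2 * k + 1) (by omega) (by omega)
    simp only [Set.indicator_apply, mem_Icc]
    split_ifs <;> first | (exfalso; grind) | norm_num
  have hM : ∀ x y, x ≤ y → |B.fn y - B.fn x| ≤ M y - M x := by
    intro x y hxy
    rw [hfn, hfn, ← Finset.sum_sub_distrib, ← Finset.sum_sub_distrib]
    refine (Finset.abs_sum_le_sum_abs _ _).trans (Finset.sum_le_sum ?_)
    intro k hk
    split_ifs <;> first | (exfalso; linarith) | norm_num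
  have hM0 : ∀ x, 0 ≤ M x := by
    intro x
    apply Finset.sum_nonneg
    intro k hk
    split_ifs <;> norm_num
  have hM1 : ∀ x, M x ≤ 2 * B.n := by
    intro x
    have : M x ≤ ∑ k ∈ Finset.range B.n, (2:ℝ) := by
      apply Finset.sum_le_sum
      intro k hk
      split_ifs <;> norm_num
    refine this.trans ?_
    simp [mul_comm]
  unfold TV eVariationOn
  apply iSup_le
  rintro ⟨m, y, hy, -⟩
  simp only
  calc ∑ i ∈ Finset.range m, edist (B.fn (y (i + 1))) (B.fn (y i))
      ≤ ∑ i ∈ Finset.range m, ENNReal.ofReal (M (y (i + 1)) - M (y i)) := by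
        apply Finset.sum_le_sum
        intro i hi
        rw [edist_dist, Real.dist_eq]
        exact ENNReal.ofReal_le_ofReal (hM _ _ (hy (Nat.le_succ i)))
    _ = ENNReal.ofReal (∑ i ∈ Finset.range m, (M (y (i + 1)) - M (y i))) := by
        rw [ENNReal.ofReal_sum_of_nonneg]
        intro i hi
        exact (abs_nonneg _).trans (hM _ _ (hy (Nat.le_succ i)))
    _ = ENNReal.ofReal (M (y m) - M (y 0)) := by rw [Finset.sum_range_sub (fun i => M (y i))]
    _ ≤ ENNReal.ofReal ((2 * B.n : ℕ) : ℝ) := by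
        apply ENNReal.ofReal_le_ofReal
        push_cast
        linarith [hM0 (y 0), hM1 (y m)]
    _ = _ := by rw [ENNReal.ofReal_natCast]

/-- lower bound on the total variation -/
lemma BarcodeRep.le_TV (B : BarcodeRep) (u : ℝ → ℝ) (h0 : ∀ x, x ∉ Icc (0:ℝ) 1 → u x = 0)
    (h : ∀ k, k + 1 < 2 * B.n → ∃ x, B.t k < x ∧ x < B.t (k + 1) ∧
      u x = if Even k then 1 else 0) : ((2 * B.n : ℕ) : ENNReal) ≤ TV u := by
  classical
  rcases Nat.eq_zero_or_pos B.n with hn | hn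
  · simp [hn]
  have h' : ∀ k, ∃ x, k + 1 < 2 * B.n → (B.t k < x ∧ x < B.t (k + 1) ∧
      u x = if Even k then 1 else 0) := by
    intro k
    by_cases hk : k + 1 < 2 * B.n
    · obtain ⟨x, hx⟩ := h k hk
      exact ⟨x, fun _ => hx⟩
    · exact ⟨0, fun h => absurd h hk⟩
  choose g hg using h'
  let y : ℕ → ℝ := fun i => if i = 0 then -1 else if i < 2 * B.n then g (i - 1) else 2
  have hlast := (BarcodeRep.t_mem (B := B) (k := 2 * B.n - 1) (by omega)).2
  have hfirst := (BarcodeRep.t_mem (B := B) (k := 0) (by omega)).1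
  have ylow : ∀ i, 0 < i → i < 2 * B.n → B.t (i - 1) < y i ∧ y i < B.t i ∧
      u (y i) = if Even i then 0 else 1 := by
    intro i hi hi2
    have := hg (i - 1) (by omega)
    rw [Nat.sub_add_cancel hi] at this
    have hy : y i = g (i - 1) := by simp [y, hi.ne', hi2]
    rw [hy]
    refine ⟨this.1, this.2.1, ?_⟩
    rw [this.2.2]
    have hp : Even (i - 1) ↔ ¬ Even i := by
      obtain ⟨j, rfl⟩ : ∃ j, i = j + 1 := ⟨i - 1, by omega⟩
      simp [Nat.even_add_one]
    by_cases he : Even i <;> simp [hp, he]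
  have y0 : y 0 = -1 := by simp [y]
  have yhi : ∀ i, 2 * B.n ≤ i → y i = 2 := by
    intro i hi
    have h1 : i ≠ 0 := by omega
    have h2 : ¬ i < 2 * B.n := by omega
    simp [y, h1, h2]
  have hmono : Monotone y := by
    apply monotone_nat_of_le_succ
    intro i
    rcases Nat.eq_zero_or_pos i with rfl | hi
    · rw [y0]
      have := (ylow 1 (by omega) (by omega)).1
      simp at this ⊢
      linarith
    · rcases lt_or_ge i (2 * B.n) with h1 | h1
      · have a1 := (ylow i hi h1).2.1
        rcases lt_or_ge (i + 1) (2 * B.n) with h2 | h2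
        · have a2 := (ylow (i + 1) (by omega) h2).1
          simp at a2
          linarith
        · rw [yhi _ h2]
          have := (BarcodeRep.t_mem (B := B) h1).2
          linarith
      · rw [yhi _ h1, yhi _ (by omega)]
  have hu : ∀ i, i ≤ 2 * B.n → u (y i) = if Even i then 0 else 1 := by
    intro i hi
    rcases Nat.eq_zero_or_pos i with rfl | hi0
    · rw [y0, h0 _ (by norm_num)]; simp
    · rcases hi.lt_or_eq with h1 | h1
      · exact (ylow i hi0 h1).2.2
      · rw [yhi _ h1.ge, h0 _ (by norm_num), h1]; simp
  have := eVariationOn.sum_le (f := u) (s := univ) (n := 2 * B.n) hmono (fun i => mem_univ _)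
  refine le_trans ?_ this
  have : ∀ i ∈ Finset.range (2 * B.n), edist (u (y (i + 1))) (u (y i)) = 1 := by
    intro i hi
    have hi' : i < 2 * B.n := by simpa using hi
    rw [hu _ hi'.le, hu (i + 1) hi', edist_dist, Real.dist_eq]
    by_cases he : Even i <;> simp [Nat.even_add_one, he]
  rw [Finset.sum_congr rfl this]
  simp

lemma BarcodeRep.TV_eq (B : BarcodeRep) : TV B.fn = ((2 * B.n : ℕ) : ENNReal) := by
  apply le_antisymm B.TV_le
  apply BarcodeRep.le_TV B _ (fun x hx => BarcodeRep.fn_zero_of_not_mem hx)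
  intro k hk
  have := BarcodeRep.lt_of (Nat.lt_succ_self k) hk
  refine ⟨(B.t k + B.t (k + 1)) / 2, ?_, ?_, ?_⟩
  · linarith
  · linarith
  · apply BarcodeRep.fn_gap hk <;> linarith

/-- the finite set of interfaces -/
def BarcodeRep.ifc (B : BarcodeRep) : Finset ℝ := (Finset.range (2 * B.n)).image B.t

lemma BarcodeRep.mem_ifc {B : BarcodeRep} {x : ℝ} : x ∈ B.ifc ↔ B.IsInterface x := by
  simp [BarcodeRep.ifc, BarcodeRep.IsInterface]

lemma BarcodeRep.injOn (B : BarcodeRep) : Set.InjOn B.t (Finset.range (2 * B.n)) := by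
  have := B.mono.injOn
  intro x hx y hy h
  exact this (by simpa using hx) (by simpa using hy) h

lemma BarcodeRep.card_ifc (B : BarcodeRep) : B.ifc.card = 2 * B.n := by
  rw [BarcodeRep.ifc, Finset.card_image_of_injOn B.injOn]; simp

/-- sign flipping function of a finite set -/
def sgnS (S : Finset ℝ) (x : ℝ) : ℝ := ∏ s ∈ S, (if s ≤ x then (-1:ℝ) else 1)

lemma sgnS_sq (S : Finset ℝ) (x : ℝ) : sgnS S x * sgnS S x = 1 := by
  rw [sgnS, ← Finset.prod_mul_distrib]
  apply Finset.prod_eq_one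
  intro s hs
  split_ifs <;> norm_num

lemma sgnS_cases (S : Finset ℝ) (x : ℝ) : sgnS S x = 1 ∨ sgnS S x = -1 :=
  mul_self_eq_one_iff.1 (sgnS_sq S x)

lemma sgnS_symmDiff (S T : Finset ℝ) (x : ℝ) :
    sgnS (symmDiff S T) x = sgnS S x * sgnS T x := by
  have h1 : sgnS S x = sgnS (S \ T) x * sgnS (S ∩ T) x := by
    unfold sgnS
    rw [← Finset.prod_union (Finset.disjoint_sdiff_inter S T), Finset.sdiff_union_inter]
  have h2 : sgnS T x = sgnS (T \ S) x * sgnS (S ∩ T) x := by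
    unfold sgnS
    rw [Finset.inter_comm S T, ← Finset.prod_union (Finset.disjoint_sdiff_inter T S),
      Finset.sdiff_union_inter]
  have h3 : sgnS (symmDiff S T) x = sgnS (S \ T) x * sgnS (T \ S) x := by
    unfold sgnS
    rw [← Finset.prod_union]
    · rfl
    · rw [Finset.disjoint_left]; simp; tauto
  rw [h1, h2, h3]
  linear_combination -(sgnS (S \ T) x * sgnS (T \ S) x) * sgnS_sq (S ∩ T) x

lemma prod_range_two_mul (f : ℕ → ℝ) (n : ℕ) :
    ∏ k ∈ Finset.range (2 * n), f k = ∏ j ∈ Finset.range n, (f (2 * j) * f (2 * j + 1)) := by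
  induction n with
  | zero => simp
  | succ n ih =>
    rw [show 2 * (n + 1) = 2 * n + 1 + 1 by ring, Finset.prod_range_succ, Finset.prod_range_succ,
      Finset.prod_range_succ, ih]
    ring

lemma BarcodeRep.fn_eq_sgn {B : BarcodeRep} {x : ℝ} (hx : x ∉ B.ifc) :
    B.fn x = (1 - sgnS B.ifc x) / 2 := by
  have h1 : sgnS B.ifc x = ∏ j ∈ Finset.range B.n,
      ((if B.t (2 * j) ≤ x then (-1:ℝ) else 1) * (if B.t (2 * j + 1) ≤ x then (-1:ℝ) else 1)) := by
    rw [← prod_range_two_mul (fun k => if B.t k ≤ x then (-1:ℝ) else 1)]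
    rw [sgnS, BarcodeRep.ifc, Finset.prod_image B.injOn]
  have hne : ∀ k, k < 2 * B.n → B.t k ≠ x := by
    intro k hk h
    exact hx (BarcodeRep.mem_ifc.2 ⟨k, hk, h⟩)
  have hone : ∀ j < B.n, ¬ (B.t (2 * j) ≤ x ∧ x ≤ B.t (2 * j + 1)) →
      ((if B.t (2 * j) ≤ x then (-1:ℝ) else 1) * (if B.t (2 * j + 1) ≤ x then (-1:ℝ) else 1)) = 1 := by
    intro j hj hh
    have := BarcodeRep.lt_of (B := B) (i := 2 * j) (j := 2 * j + 1) (by omega) (by omega)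
    split_ifs <;> first | (exfalso; grind) | norm_num
  by_cases h : x ∈ B.supp
  · rw [BarcodeRep.fn_of_mem h]
    obtain ⟨k, hk, h3, h2⟩ := BarcodeRep.mem_supp.1 h
    rw [h1, Finset.prod_eq_single k]
    · have : ¬ B.t (2 * k + 1) ≤ x := by
        intro h5
        exact hne (2 * k + 1) (by omega) (le_antisymm h5 h2)
      simp [h3, this]
    · intro i hi hik
      have hi' : i < B.n := by simpa using hi
      apply hone i hi'
      rintro ⟨h3, h4⟩
      rcases lt_or_gt_of_ne hik with hlt | hlt
      · have := BarcodeRep.lt_of (B := B) (i := 2 * i + 1) (j := 2 * k) (by omega) (by omega)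
        linarith
      · have := BarcodeRep.lt_of (B := B) (i := 2 * k + 1) (j := 2 * i) (by omega) (by omega)
        linarith
    · intro h; simp at h; omega
  · rw [BarcodeRep.fn_of_not_mem h, h1, Finset.prod_eq_one]
    · norm_num
    · intro i hi
      have hi' : i < B.n := by simpa using hi
      exact hone i hi' fun hh => h (BarcodeRep.mem_supp.2 ⟨i, hi', hh⟩)

/-- every finite subset of `[0,1]` with an even number of points is the set of interfaces of a
bar code -/
lemma exists_barcode (S : Finset ℝ) (hS : ∀ s ∈ S, s ∈ Icc (0:ℝ) 1) (hc : Even S.card) :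
    ∃ B : BarcodeRep, B.ifc = S := by
  obtain ⟨n, hn⟩ := hc
  have hn' : S.card = 2 * n := by omega
  let t : ℕ → ℝ := fun k => if h : k < 2 * n then S.orderEmbOfFin hn' ⟨k, h⟩ else 0
  have ht : ∀ k (h : k < 2 * n), t k = S.orderEmbOfFin hn' ⟨k, h⟩ := by
    intro k h; simp [t, h]
  have hmem : ∀ k, k < 2 * n → t k ∈ S := by
    intro k h; rw [ht k h]; exact Finset.orderEmbOfFin_mem _ _ _
  refine ⟨⟨n, t, ?_, ?_, ?_⟩, ?_⟩
  · intro i hi j hj hij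
    rw [ht i hi, ht j hj]
    exact (S.orderEmbOfFin hn').strictMono (Fin.mk_lt_mk.2 hij)
  · intro h
    exact (hS _ (hmem 0 (by omega))).1
  · intro h
    exact (hS _ (hmem (2 * n - 1) (by omega))).2
  · apply Finset.eq_of_subset_of_card_le
    · intro x hx
      obtain ⟨k, hk, rfl⟩ := BarcodeRep.mem_ifc.1 hx
      exact hmem k hk
    · rw [BarcodeRep.card_ifc, hn']

lemma ae_notMem (S : Finset ℝ) : ∀ᵐ x : ℝ, x ∉ S := by
  have : volume (S : Set ℝ) = 0 := S.measure_zero _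
  exact measure_eq_zero_iff_ae_notMem.1 this

/-- flipping a bar code on an interval -/
lemma BarcodeRep.exists_flip (U : BarcodeRep) {a b : ℝ} (ha : 0 ≤ a) (hab : a < b) (hb : b ≤ 1) :
    ∃ V : BarcodeRep, V.n ≤ U.n + 1 ∧
      (∀ᵐ x : ℝ, V.fn x = if x ∈ Icc a b then 1 - U.fn x else U.fn x) := by
  have hpair : ({a, b} : Finset ℝ).card = 2 := Finset.card_pair hab.ne
  have hcard : (symmDiff U.ifc {a, b}).card + 2 * (U.ifc ∩ {a, b}).card = 2 * U.n + 2 := by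
    have h1 := Finset.card_sdiff_add_card_inter U.ifc {a, b}
    have h2 := Finset.card_sdiff_add_card_inter {a, b} U.ifc
    have h3 : (symmDiff U.ifc {a, b}).card = (U.ifc \ {a, b}).card + ({a, b} \ U.ifc).card := by
      rw [← Finset.card_union_of_disjoint]
      · rfl
      · rw [Finset.disjoint_left]; intro x hx hx'
        exact (Finset.mem_sdiff.1 hx').2 (Finset.mem_sdiff.1 hx).1
    rw [Finset.inter_comm {a, b}] at h2
    rw [U.card_ifc] at h1
    omega
  obtain ⟨V, hV⟩ := exists_barcode (symmDiff U.ifc {a, b}) (by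
    intro s hs
    rcases Finset.mem_symmDiff.1 hs with h | h
    · obtain ⟨k, hk, rfl⟩ := BarcodeRep.mem_ifc.1 h.1
      exact BarcodeRep.t_mem hk
    · have := h.1
      simp only [Finset.mem_insert, Finset.mem_singleton] at this
      rcases this with rfl | rfl
      · exact ⟨ha, by linarith⟩
      · exact ⟨by linarith, hb⟩) ⟨U.n + 1 - (U.ifc ∩ {a, b}).card, by omega⟩
  refine ⟨V, ?_, ?_⟩
  · have := V.card_ifc
    rw [hV] at this
    omega
  · filter_upwards [ae_notMem U.ifc, ae_notMem V.ifc, ae_notMem {a, b}] with x h1 h2 h3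
    rw [BarcodeRep.fn_eq_sgn h1, BarcodeRep.fn_eq_sgn h2, hV, sgnS_symmDiff]
    have hs : sgnS {a, b} x = (if a ≤ x then (-1:ℝ) else 1) * (if b ≤ x then (-1:ℝ) else 1) := by
      rw [sgnS, Finset.prod_pair hab.ne]
    simp only [Finset.mem_insert, Finset.mem_singleton, not_or] at h3
    rw [hs]
    by_cases hax : a ≤ x
    · by_cases hbx : b ≤ x
      · have : ¬ (x ≤ b) := fun h => h3.2 (le_antisymm h hbx)
        simp [hax, hbx, this]
      · simp [hax, hbx, (not_le.1 hbx).le]; ring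
    · have hbx : ¬ b ≤ x := by intro h; linarith
      simp [hax, hbx]

/-- behaviour of a wide bar code near an interface -/
lemma BarcodeRep.fn_near_right {Z : BarcodeRep} {ω : ℝ} (hZ : Z.MinWidth ω) {k : ℕ}
    (hk : k < 2 * Z.n) {x : ℝ} (h1 : Z.t k < x) (h2 : x < Z.t k + ω) :
    Z.fn x = if Even k then 1 else 0 := by
  rcases lt_or_ge (k + 1) (2 * Z.n) with h | h
  · apply BarcodeRep.fn_gap h h1
    rcases Nat.even_or_odd' k with ⟨j, rfl | rfl⟩
    · have := hZ.1 j (by omega); linarith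
    · have := hZ.2.1 j (by omega)
      rw [show 2 * j + 1 + 1 = 2 * j + 2 by ring]; linarith
  · have hk' : k = 2 * Z.n - 1 := by omega
    have ho : ¬ Even k := by
      rw [Nat.not_even_iff_odd]; exact ⟨Z.n - 1, by omega⟩
    rw [if_neg ho]
    apply BarcodeRep.fn_right
    rw [← hk']; exact h1

lemma BarcodeRep.fn_near_left {Z : BarcodeRep} {ω : ℝ} (hZ : Z.MinWidth ω) {k : ℕ}
    (hk : k < 2 * Z.n) {x : ℝ} (h1 : x < Z.t k) (h2 : Z.t k - ω < x) :
    Z.fn x = if Even k then 0 else 1 := by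
  rcases k with _ | k
  · simpa using BarcodeRep.fn_left h1
  · have h3 : Z.t k < x := by
      rcases Nat.even_or_odd' k with ⟨j, rfl | rfl⟩
      · have := hZ.1 j (by omega); linarith
      · have := hZ.2.1 j (by omega)
        rw [show 2 * j + 1 + 1 = 2 * j + 2 by ring] at h2; linarith
    rw [BarcodeRep.fn_gap hk h3 h1]
    by_cases he : Even k <;> simp [Nat.even_add_one, he]

lemma BarcodeRep.gap_ge {Z : BarcodeRep} {ω : ℝ} (hZ : Z.MinWidth ω) {k : ℕ}
    (hk : k + 1 < 2 * Z.n) : ω ≤ Z.t (k + 1) - Z.t k := by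
  rcases Nat.even_or_odd' k with ⟨j, rfl | rfl⟩
  · exact hZ.1 j (by omega)
  · exact hZ.2.1 j (by omega)

/-! ### The hat kernel -/

lemma hat_eq_max {σ : ℝ} (hσ : 0 < σ) (x : ℝ) : hatKernel σ x = max 0 ((1 - |x| / σ) / σ) := by
  unfold hatKernel
  split_ifs with h
  · rw [max_eq_right]
    have : |x| / σ ≤ 1 := (div_le_one hσ).2 h.le
    exact div_nonneg (by linarith) hσ.le
  · rw [max_eq_left]
    have : 1 ≤ |x| / σ := (one_le_div hσ).2 (not_lt.1 h)
    exact div_nonpos_of_nonpos_of_nonneg (by linarith) hσ.le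

lemma hat_continuous {σ : ℝ} (hσ : 0 < σ) : Continuous (hatKernel σ) := by
  have : hatKernel σ = fun x => max 0 ((1 - |x| / σ) / σ) := funext (hat_eq_max hσ)
  rw [this]
  fun_prop

lemma hat_even (σ x : ℝ) : hatKernel σ (-x) = hatKernel σ x := by simp [hatKernel]

lemma hat_sub_comm (σ x y : ℝ) : hatKernel σ (x - y) = hatKernel σ (y - x) := by
  rw [← hat_even, neg_sub]

lemma hat_nonneg {σ : ℝ} (hσ : 0 < σ) (x : ℝ) : 0 ≤ hatKernel σ x := by
  rw [hat_eq_max hσ]; exact le_max_left _ _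

lemma hat_anti {σ : ℝ} (hσ : 0 < σ) {x y : ℝ} (h : |x| ≤ |y|) :
    hatKernel σ y ≤ hatKernel σ x := by
  rw [hat_eq_max hσ, hat_eq_max hσ]
  gcongr

lemma hat_le {σ : ℝ} (hσ : 0 < σ) (x : ℝ) : hatKernel σ x ≤ hatKernel σ 0 :=
  hat_anti hσ (by simp)

lemma hat_zero {σ x : ℝ} (h : σ ≤ |x|) : hatKernel σ x = 0 := by
  simp [hatKernel, not_lt.2 h]

lemma hat_compact (σ : ℝ) : HasCompactSupport (hatKernel σ) := by
  apply HasCompactSupport.of_support_subset_isCompact (isCompact_Icc (a := -σ) (b := σ))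
  intro x hx
  rw [mem_Icc, ← abs_le]
  by_contra h
  exact hx (hat_zero (not_le.1 h).le)

/-! ### Convolution with the hat kernel -/

lemma conv_int {σ : ℝ} (hσ : 0 < σ) {f : ℝ → ℝ} (hf : Integrable f) (x : ℝ) :
    Integrable (fun y => hatKernel σ (x - y) * f y) := by
  apply hf.bdd_mul (c := hatKernel σ 0)
  · exact ((hat_continuous hσ).comp (continuous_const.sub continuous_id)).aestronglyMeasurable
  · filter_upwards with y
    rw [Real.norm_of_nonneg (hat_nonneg hσ _)]
    exact hat_le hσ _

lemma conv_add {σ : ℝ} (hσ : 0 < σ) {f g : ℝ → ℝ} (hf : Integrable f) (hg : Integrable g) (x : ℝ) :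
    conv (hatKernel σ) (fun y => f y + g y) x =
      conv (hatKernel σ) f x + conv (hatKernel σ) g x := by
  unfold conv
  rw [← integral_add (conv_int hσ hf x) (conv_int hσ hg x)]
  congr 1; ext y; ring

lemma conv_sub {σ : ℝ} (hσ : 0 < σ) {f g : ℝ → ℝ} (hf : Integrable f) (hg : Integrable g) (x : ℝ) :
    conv (hatKernel σ) (fun y => f y - g y) x =
      conv (hatKernel σ) f x - conv (hatKernel σ) g x := by
  unfold conv
  rw [← integral_sub (conv_int hσ hf x) (conv_int hσ hg x)]
  congr 1; ext y; ring

lemma conv_const_mul (σ c : ℝ) (f : ℝ → ℝ) (x : ℝ) :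
    conv (hatKernel σ) (fun y => c * f y) x = c * conv (hatKernel σ) f x := by
  unfold conv
  rw [← integral_const_mul]
  congr 1; ext y; ring

lemma conv_sum {σ : ℝ} (hσ : 0 < σ) {ι : Type*} (s : Finset ι) {f : ι → ℝ → ℝ}
    (hf : ∀ i ∈ s, Integrable (f i)) (x : ℝ) :
    conv (hatKernel σ) (fun y => ∑ i ∈ s, f i y) x = ∑ i ∈ s, conv (hatKernel σ) (f i) x := by
  unfold conv
  rw [← integral_finsetSum _ (fun i hi => conv_int hσ (hf i hi) x)]
  congr 1; ext y; rw [Finset.mul_sum]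

lemma conv_congr (σ : ℝ) {f g : ℝ → ℝ} (h : f =ᵐ[volume] g) (x : ℝ) :
    conv (hatKernel σ) f x = conv (hatKernel σ) g x := by
  unfold conv
  apply integral_congr_ae
  filter_upwards [h] with y hy
  rw [hy]

lemma conv_mono {σ : ℝ} (hσ : 0 < σ) {f g : ℝ → ℝ} (hf : Integrable f) (hg : Integrable g)
    (h : f ≤ᵐ[volume] g) (x : ℝ) :
    conv (hatKernel σ) f x ≤ conv (hatKernel σ) g x := by
  unfold conv
  apply integral_mono_ae (conv_int hσ hf x) (conv_int hσ hg x)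
  filter_upwards [h] with y hy
  exact mul_le_mul_of_nonneg_left hy (hat_nonneg hσ _)

lemma conv_nonneg {σ : ℝ} (hσ : 0 < σ) {f : ℝ → ℝ} (h : ∀ y, 0 ≤ f y) (x : ℝ) :
    0 ≤ conv (hatKernel σ) f x := by
  unfold conv
  exact integral_nonneg fun y => mul_nonneg (hat_nonneg hσ _) (h y)

lemma conv_eq_convolution (φ f : ℝ → ℝ) :
    conv φ f = MeasureTheory.convolution f φ (ContinuousLinearMap.mul ℝ ℝ) volume := by
  ext x
  simp only [conv, MeasureTheory.convolution, ContinuousLinearMap.mul_apply']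
  congr 1; ext y; ring

lemma conv_continuous {σ : ℝ} (hσ : 0 < σ) {f : ℝ → ℝ} (hf : Integrable f) :
    Continuous (conv (hatKernel σ) f) := by
  rw [conv_eq_convolution]
  exact (hat_compact σ).continuous_convolution_right _ hf.locallyIntegrable (hat_continuous hσ)

lemma conv_compact (σ : ℝ) {f : ℝ → ℝ} (hf : HasCompactSupport f) :
    HasCompactSupport (conv (hatKernel σ) f) := by
  rw [conv_eq_convolution]
  exact HasCompactSupport.convolution _ hf (hat_compact σ)

/-- the convolution with the (even) hat kernel is symmetric -/
lemma conv_symm {σ : ℝ} (hσ : 0 < σ) {f h : ℝ → ℝ} (hf : Integrable f) (hh : Integrable h) :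
    ∫ x, conv (hatKernel σ) f x * h x = ∫ x, f x * conv (hatKernel σ) h x := by
  have hint : Integrable (fun z : ℝ × ℝ => hatKernel σ (z.1 - z.2) * (h z.1 * f z.2))
      (volume.prod volume) := by
    apply (hh.mul_prod hf).bdd_mul (c := hatKernel σ 0)
    · exact ((hat_continuous hσ).comp (continuous_fst.sub continuous_snd)).aestronglyMeasurable
    · filter_upwards with y
      rw [Real.norm_of_nonneg (hat_nonneg hσ _)]
      exact hat_le hσ _
  have := integral_integral_swap (f := fun x y => hatKernel σ (x - y) * (h x * f y)) hint
  calc ∫ x, conv (hatKernel σ) f x * h x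
      = ∫ x, ∫ y, hatKernel σ (x - y) * (h x * f y) := by
        congr 1; ext x
        rw [conv, ← integral_mul_const]
        congr 1; ext y; ring
    _ = ∫ y, ∫ x, hatKernel σ (x - y) * (h x * f y) := this
    _ = _ := by
        congr 1; ext y
        rw [conv, ← integral_const_mul]
        congr 1; ext x
        rw [hat_sub_comm]; ring

/-! ### The primitive of the hat kernel -/

/-- odd primitive of the hat kernel -/
def Psi (σ x : ℝ) : ℝ := ∫ y in (0:ℝ)..x, hatKernel σ y

lemma hat_ii {σ : ℝ} (hσ : 0 < σ) (a b : ℝ) : IntervalIntegrable (hatKernel σ) volume a b :=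
  (hat_continuous hσ).intervalIntegrable a b

lemma Psi_sub {σ : ℝ} (hσ : 0 < σ) (a b : ℝ) :
    Psi σ b - Psi σ a = ∫ y in a..b, hatKernel σ y := by
  unfold Psi
  exact intervalIntegral.integral_interval_sub_left (hat_ii hσ _ _) (hat_ii hσ _ _)

lemma Psi_mono {σ : ℝ} (hσ : 0 < σ) : Monotone (Psi σ) := by
  intro a b hab
  rw [← sub_nonneg, Psi_sub hσ]
  exact intervalIntegral.integral_nonneg hab fun x _ => hat_nonneg hσ x

lemma Psi_continuous {σ : ℝ} (hσ : 0 < σ) : Continuous (Psi σ) :=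
  intervalIntegral.continuous_primitive (hat_ii hσ) 0

lemma Psi_neg (σ x : ℝ) : Psi σ (-x) = - Psi σ x := by
  unfold Psi
  have := intervalIntegral.integral_comp_neg (a := 0) (b := x) (hatKernel σ)
  simp only [hat_even, neg_zero] at this
  rw [this, intervalIntegral.integral_symm]

lemma Psi_mid {σ x : ℝ} (hσ : 0 < σ) (h0 : 0 ≤ x) (h1 : x ≤ σ) :
    Psi σ x = x / σ - x ^ 2 / (2 * σ ^ 2) := by
  unfold Psi
  have : ∫ y in (0:ℝ)..x, hatKernel σ y = ∫ y in (0:ℝ)..x, (1 / σ - 1 / σ ^ 2 * y) := by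
    apply intervalIntegral.integral_congr
    intro y hy
    rw [uIcc_of_le h0] at hy
    simp only
    rw [hat_eq_max hσ, abs_of_nonneg hy.1, max_eq_right]
    · field_simp
    · have : y / σ ≤ 1 := (div_le_one hσ).2 (hy.2.trans h1)
      exact div_nonneg (by linarith) hσ.le
  rw [this, intervalIntegral.integral_sub (by simp) (by
    apply Continuous.intervalIntegrable; fun_prop), intervalIntegral.integral_const_mul,
    integral_id, intervalIntegral.integral_const]
  simp only [smul_eq_mul]
  field_simp
  ring

lemma Psi_hi {σ x : ℝ} (hσ : 0 < σ) (h : σ ≤ x) : Psi σ x = 1 / 2 := by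
  have h1 : Psi σ x - Psi σ σ = 0 := by
    rw [Psi_sub hσ]
    have : ∫ y in σ..x, hatKernel σ y = ∫ y in σ..x, (0:ℝ) := by
      apply intervalIntegral.integral_congr
      intro y hy
      rw [uIcc_of_le h] at hy
      exact hat_zero (hy.1.trans (le_abs_self y))
    rw [this]; simp
  rw [Psi_mid hσ hσ.le le_rfl] at h1
  have : σ / σ - σ ^ 2 / (2 * σ ^ 2) = 1 / 2 := by field_simp; norm_num
  linarith

lemma Psi_lo {σ x : ℝ} (hσ : 0 < σ) (h : x ≤ -σ) : Psi σ x = -(1 / 2) := by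
  have := Psi_hi hσ (x := -x) (by linarith)
  rw [Psi_neg] at this
  linarith

lemma Psi_le {σ : ℝ} (hσ : 0 < σ) (x : ℝ) : Psi σ x ≤ 1 / 2 := by
  have := Psi_mono hσ (le_max_left x σ)
  rwa [Psi_hi hσ (le_max_right x σ)] at this

lemma Psi_ge {σ : ℝ} (hσ : 0 < σ) (x : ℝ) : -(1 / 2) ≤ Psi σ x := by
  have := Psi_le hσ (-x)
  rw [Psi_neg] at this
  linarith

lemma Psi_zero (σ : ℝ) : Psi σ 0 = 0 := by simp [Psi]

lemma Psi_compare {σ ρ : ℝ} (hσ : 0 < σ) (h : σ ≤ ρ) {x : ℝ} (hx : 0 ≤ x) :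
    Psi ρ x ≤ Psi σ x := by
  rcases le_total σ x with h1 | h1
  · rw [Psi_hi hσ h1]; exact Psi_le (hσ.trans_le h) x
  · rw [Psi_mid hσ hx h1, Psi_mid (hσ.trans_le h) hx (h1.trans h)]
    have e1 : x / σ - x ^ 2 / (2 * σ ^ 2) = x / σ - (x / σ) ^ 2 / 2 := by field_simp
    have e2 : x / ρ - x ^ 2 / (2 * ρ ^ 2) = x / ρ - (x / ρ) ^ 2 / 2 := by
      have := hσ.trans_le h
      field_simp
    rw [e1, e2]
    have a1 : x / σ ≤ 1 := (div_le_one hσ).2 h1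
    have a2 : x / ρ ≤ x / σ := by gcongr
    nlinarith

/-- convolution of the hat kernel with the characteristic function of an interval -/
lemma conv_Icc {σ : ℝ} (hσ : 0 < σ) {a b : ℝ} (hab : a ≤ b) (x : ℝ) :
    conv (hatKernel σ) ((Icc a b).indicator fun _ => (1:ℝ)) x = Psi σ (x - a) - Psi σ (x - b) := by
  rw [Psi_sub hσ]
  unfold conv
  have : (fun y => hatKernel σ (x - y) * (Icc a b).indicator (fun _ => (1:ℝ)) y) =
      (Icc a b).indicator (fun y => hatKernel σ (x - y)) := by
    ext y
    by_cases hy : y ∈ Icc a b <;> simp [hy]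
  rw [this, integral_indicator measurableSet_Icc, integral_Icc_eq_integral_Ioc,
    ← intervalIntegral.integral_of_le hab, intervalIntegral.integral_comp_sub_left]

lemma int_Icc (a b : ℝ) : Integrable ((Icc a b).indicator fun _ => (1:ℝ)) :=
  (integrable_indicator_iff measurableSet_Icc).2 (integrableOn_const (by simp))

lemma compact_Icc (a b : ℝ) : HasCompactSupport ((Icc a b).indicator fun _ => (1:ℝ)) :=
  HasCompactSupport.of_support_subset_isCompact isCompact_Icc Set.support_indicator_subset

lemma BarcodeRep.fn_eq_sum' (B : BarcodeRep) :
    B.fn = fun x => ∑ k ∈ Finset.range B.n,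
      (Icc (B.t (2 * k)) (B.t (2 * k + 1))).indicator (fun _ => (1:ℝ)) x :=
  funext B.fn_eq_sum

lemma BarcodeRep.fn_int (B : BarcodeRep) : Integrable B.fn := by
  rw [B.fn_eq_sum']
  exact integrable_finsetSum _ fun i _ => int_Icc _ _

lemma BarcodeRep.fn_compact (B : BarcodeRep) : HasCompactSupport B.fn :=
  HasCompactSupport.of_support_subset_isCompact (isCompact_Icc (a := (0:ℝ)) (b := 1)) (by
    intro x hx
    by_contra h
    exact hx (BarcodeRep.fn_zero_of_not_mem h))

lemma sum_range_two_mul_alt (f : ℕ → ℝ) (n : ℕ) :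
    ∑ k ∈ Finset.range (2 * n), (-1) ^ k * f k =
      ∑ j ∈ Finset.range n, (f (2 * j) - f (2 * j + 1)) := by
  induction n with
  | zero => simp
  | succ n ih =>
    rw [show 2 * (n + 1) = 2 * n + 1 + 1 by ring, Finset.sum_range_succ, Finset.sum_range_succ,
      Finset.sum_range_succ, ih]
    rw [pow_succ, pow_mul]
    simp
    ring

lemma BarcodeRep.conv_fn {σ : ℝ} (hσ : 0 < σ) (B : BarcodeRep) (x : ℝ) :
    conv (hatKernel σ) B.fn x = ∑ k ∈ Finset.range (2 * B.n), (-1) ^ k * Psi σ (x - B.t k) := by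
  rw [sum_range_two_mul_alt (fun k => Psi σ (x - B.t k)), B.fn_eq_sum',
    conv_sum hσ _ (fun i _ => int_Icc _ _)]
  apply Finset.sum_congr rfl
  intro k hk
  have hk' : k < B.n := by simpa using hk
  exact conv_Icc hσ (BarcodeRep.le_of (by omega) (by omega)) x

/-! ### Explicit integral for the flipping step -/

lemma integral_quartic (l r c0 c1 c2 c3 c4 : ℝ) :
    ∫ x in l..r, (c0 + c1 * x + c2 * x ^ 2 + c3 * x ^ 3 + c4 * x ^ 4) =
      (c0 * r + c1 * r ^ 2 / 2 + c2 * r ^ 3 / 3 + c3 * r ^ 4 / 4 + c4 * r ^ 5 / 5) -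
      (c0 * l + c1 * l ^ 2 / 2 + c2 * l ^ 3 / 3 + c3 * l ^ 4 / 4 + c4 * l ^ 5 / 5) := by
  apply intervalIntegral.integral_eq_sub_of_hasDerivAt (f := fun x =>
    c0 * x + c1 * x ^ 2 / 2 + c2 * x ^ 3 / 3 + c3 * x ^ 4 / 4 + c4 * x ^ 5 / 5)
  · intro x _
    have h1 := ((hasDerivAt_id x).const_mul c0)
    have h2 := (((hasDerivAt_pow 2 x).const_mul c1).div_const 2)
    have h3 := (((hasDerivAt_pow 3 x).const_mul c2).div_const 3)
    have h4 := (((hasDerivAt_pow 4 x).const_mul c3).div_const 4)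
    have h5 := (((hasDerivAt_pow 5 x).const_mul c4).div_const 5)
    convert! (((h1.add h2).add h3).add h4).add h5 using 1
    norm_num
    ring
  · apply Continuous.intervalIntegrable; fun_prop

/-- transition profile -/
def tau (ρ σ s : ℝ) : ℝ :=
  2 * (1 / 2 + Psi ρ s) - (1 / 2 + Psi ρ s) ^ 2 - 2 * (1 / 2 + Psi ρ s) * (1 / 2 + Psi σ s)

lemma tau_continuous {ρ σ : ℝ} (hσ : 0 < σ) (hρ : 0 < ρ) : Continuous (tau ρ σ) := by
  have h1 := Psi_continuous hσ
  have h2 := Psi_continuous hρ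
  unfold tau
  fun_prop

lemma tau_add_neg (ρ σ s : ℝ) :
    tau ρ σ s + tau ρ σ (-s) = 1 / 2 - 2 * Psi ρ s ^ 2 - 4 * Psi ρ s * Psi σ s := by
  unfold tau
  rw [Psi_neg, Psi_neg]
  ring

lemma tau_integral {ρ σ : ℝ} (hσ : 0 < σ) (h : σ ≤ ρ) :
    ∫ s in (-ρ)..ρ, tau ρ σ s = -ρ + 17 / 30 * ρ + σ ^ 2 / (6 * ρ) - σ ^ 3 / (30 * ρ ^ 2) := by
  have hρ : 0 < ρ := hσ.trans_le h
  have hc := tau_continuous hσ hρ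
  have hP1 := Psi_continuous hσ
  have hP2 := Psi_continuous hρ
  have hii : ∀ a b, IntervalIntegrable (tau ρ σ) volume a b := fun a b => hc.intervalIntegrable a b
  have e1 : ∫ s in (-ρ)..0, tau ρ σ s = ∫ s in (0:ℝ)..ρ, tau ρ σ (-s) := by
    rw [intervalIntegral.integral_comp_neg]; simp
  have hcn : Continuous (fun s => tau ρ σ (-s)) := hc.comp continuous_neg
  have hE : Continuous (fun s => 1 / 2 - 2 * Psi ρ s ^ 2 - 4 * Psi ρ s * Psi σ s) := by fun_prop
  rw [← intervalIntegral.integral_add_adjacent_intervals (hii (-ρ) 0) (hii 0 ρ), e1,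
    ← intervalIntegral.integral_add (hcn.intervalIntegrable _ _) (hii _ _)]
  have e2 : ∀ s, tau ρ σ (-s) + tau ρ σ s = 1 / 2 - 2 * Psi ρ s ^ 2 - 4 * Psi ρ s * Psi σ s := by
    intro s; rw [add_comm, tau_add_neg]
  simp_rw [e2]
  rw [← intervalIntegral.integral_add_adjacent_intervals (hE.intervalIntegrable 0 σ)
    (hE.intervalIntegrable σ ρ)]
  have e3 : ∫ s in (0:ℝ)..σ, (1 / 2 - 2 * Psi ρ s ^ 2 - 4 * Psi ρ s * Psi σ s) =
      ∫ s in (0:ℝ)..σ, (1 / 2 + 0 * s + (-2 / ρ ^ 2 - 4 / (ρ * σ)) * s ^ 2 +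
        (2 / ρ ^ 3 + 2 / (ρ * σ ^ 2) + 2 / (ρ ^ 2 * σ)) * s ^ 3 +
        (-1 / (2 * ρ ^ 4) - 1 / (ρ ^ 2 * σ ^ 2)) * s ^ 4) := by
    apply intervalIntegral.integral_congr
    intro s hs
    rw [uIcc_of_le hσ.le] at hs
    simp only
    rw [Psi_mid hσ hs.1 hs.2, Psi_mid hρ hs.1 (hs.2.trans h)]
    field_simp
    ring
  have e4 : ∫ s in σ..ρ, (1 / 2 - 2 * Psi ρ s ^ 2 - 4 * Psi ρ s * Psi σ s) =
      ∫ s in σ..ρ, (1 / 2 + (-2 / ρ) * s + (-2 / ρ ^ 2 + 1 / ρ ^ 2) * s ^ 2 +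
        (2 / ρ ^ 3) * s ^ 3 + (-1 / (2 * ρ ^ 4)) * s ^ 4) := by
    apply intervalIntegral.integral_congr
    intro s hs
    rw [uIcc_of_le h] at hs
    simp only
    rw [Psi_hi hσ hs.1, Psi_mid hρ (hσ.le.trans hs.1) hs.2]
    field_simp
    ring
  rw [e3, e4, integral_quartic, integral_quartic]
  field_simp
  ring

lemma flip_integral {ρ σ a b : ℝ} (hσ : 0 < σ) (h : σ ≤ ρ) (hab : 2 * ρ ≤ b - a) :
    ∫ x, (2 * (Psi ρ (x - a) - Psi ρ (x - b)) - (Psi ρ (x - a) - Psi ρ (x - b)) ^ 2 -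
      2 * (Psi ρ (x - a) - Psi ρ (x - b)) * (Psi σ (x - a) - Psi σ (x - b))) =
    -(b - a) + 1 / (15 * ρ ^ 2) * (-σ ^ 3 + 5 * ρ * σ ^ 2 + 17 * ρ ^ 3) := by
  have hρ : 0 < ρ := hσ.trans_le h
  have hP1 := Psi_continuous hσ
  have hP2 := Psi_continuous hρ
  set T : ℝ → ℝ := fun x =>
    (2 * (Psi ρ (x - a) - Psi ρ (x - b)) - (Psi ρ (x - a) - Psi ρ (x - b)) ^ 2 -
      2 * (Psi ρ (x - a) - Psi ρ (x - b)) * (Psi σ (x - a) - Psi σ (x - b))) with hT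
  have hTc : Continuous T := by rw [hT]; fun_prop
  have hsupp : Function.support T ⊆ Ioc (a - ρ) (b + ρ) := by
    intro x hx
    by_contra hx'
    apply hx
    have hP : Psi ρ (x - a) - Psi ρ (x - b) = 0 := by
      rcases le_or_gt x (a - ρ) with h1 | h1
      · rw [Psi_lo hρ (by linarith), Psi_lo hρ (by linarith)]; ring
      · have h2 : b + ρ < x := by
          by_contra h3
          exact hx' ⟨h1, not_lt.1 h3⟩
        rw [Psi_hi hρ (by linarith), Psi_hi hρ (by linarith)]; ring
    simp only [hT, hP]; ring
  rw [← intervalIntegral.integral_eq_integral_of_support_subset hsupp]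
  have hii : ∀ l r, IntervalIntegrable T volume l r := fun l r => hTc.intervalIntegrable l r
  rw [← intervalIntegral.integral_add_adjacent_intervals (hii (a - ρ) (a + ρ)) (hii (a + ρ) (b + ρ)),
    ← intervalIntegral.integral_add_adjacent_intervals (hii (a + ρ) (b - ρ)) (hii (b - ρ) (b + ρ))]
  have e1 : ∫ x in (a - ρ)..(a + ρ), T x = ∫ x in (a - ρ)..(a + ρ), tau ρ σ (x - a) := by
    apply intervalIntegral.integral_congr
    intro x hx
    rw [uIcc_of_le (by linarith)] at hx
    simp only [hT, tau]
    rw [Psi_lo hρ (x := x - b) (by linarith [hx.2]), Psi_lo hσ (x := x - b) (by linarith [hx.2])]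
    ring
  have e2 : ∫ x in (a + ρ)..(b - ρ), T x = ∫ x in (a + ρ)..(b - ρ), (-1:ℝ) := by
    apply intervalIntegral.integral_congr
    intro x hx
    rw [uIcc_of_le (by linarith)] at hx
    simp only [hT]
    rw [Psi_lo hρ (x := x - b) (by linarith [hx.2]), Psi_lo hσ (x := x - b) (by linarith [hx.2]),
      Psi_hi hρ (x := x - a) (by linarith [hx.1]), Psi_hi hσ (x := x - a) (by linarith [hx.1])]
    norm_num
  have e3 : ∫ x in (b - ρ)..(b + ρ), T x = ∫ x in (b - ρ)..(b + ρ), tau ρ σ (b - x) := by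
    apply intervalIntegral.integral_congr
    intro x hx
    rw [uIcc_of_le (by linarith)] at hx
    simp only [hT, tau]
    rw [Psi_hi hρ (x := x - a) (by linarith [hx.1]), Psi_hi hσ (x := x - a) (by linarith [hx.1]),
      ← neg_sub x b, Psi_neg, Psi_neg]
    ring
  rw [e1, e2, e3, intervalIntegral.integral_comp_sub_right (tau ρ σ),
    intervalIntegral.integral_comp_sub_left (tau ρ σ)]
  rw [show a - ρ - a = -ρ by ring, show a + ρ - a = ρ by ring, show b - (b + ρ) = -ρ by ring,
    show b - (b - ρ) = ρ by ring, tau_integral hσ h]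
  simp
  field_simp
  ring

/-! ### Sign of the blurred transition difference -/

/-- difference of two transition profiles -/
def h0 (ρ σ x : ℝ) : ℝ := Psi ρ x - Psi σ x

lemma h0_neg (ρ σ x : ℝ) : h0 ρ σ (-x) = - h0 ρ σ x := by
  unfold h0; rw [Psi_neg, Psi_neg]; ring

lemma h0_nonpos {ρ σ : ℝ} (hσ : 0 < σ) (h : σ ≤ ρ) {x : ℝ} (hx : 0 ≤ x) : h0 ρ σ x ≤ 0 := by
  unfold h0; linarith [Psi_compare hσ h hx]

lemma h0_nonneg {ρ σ : ℝ} (hσ : 0 < σ) (h : σ ≤ ρ) {x : ℝ} (hx : x ≤ 0) : 0 ≤ h0 ρ σ x := by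
  have := h0_nonpos hσ h (x := -x) (by linarith)
  rw [h0_neg] at this; linarith

lemma h0_zero {ρ σ : ℝ} (hσ : 0 < σ) (h : σ ≤ ρ) {x : ℝ} (hx : ρ ≤ |x|) : h0 ρ σ x = 0 := by
  have hρ : 0 < ρ := hσ.trans_le h
  unfold h0
  rcases le_abs.1 hx with h1 | h1
  · rw [Psi_hi hρ h1, Psi_hi hσ (h.trans h1)]; ring
  · rw [Psi_lo hρ (by linarith), Psi_lo hσ (by linarith)]; ring

lemma h0_continuous {ρ σ : ℝ} (hσ : 0 < σ) (h : σ ≤ ρ) : Continuous (h0 ρ σ) :=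
  (Psi_continuous (hσ.trans_le h)).sub (Psi_continuous hσ)

lemma h0_int {ρ σ : ℝ} (hσ : 0 < σ) (h : σ ≤ ρ) : Integrable (h0 ρ σ) := by
  apply (h0_continuous hσ h).integrable_of_hasCompactSupport
  apply HasCompactSupport.of_support_subset_isCompact (isCompact_Icc (a := -ρ) (b := ρ))
  intro x hx
  rw [mem_Icc, ← abs_le]
  by_contra h'
  exact hx (h0_zero hσ h (not_le.1 h').le)

/-- the blurred transition difference -/
def GG (ρ σ : ℝ) : ℝ → ℝ := conv (hatKernel ρ) (h0 ρ σ)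

lemma GG_neg (ρ σ x : ℝ) : GG ρ σ (-x) = - GG ρ σ x := by
  unfold GG conv
  rw [← integral_neg_eq_self, ← integral_neg]
  congr 1; ext y
  rw [h0_neg, ← hat_even, show -(-x - -y) = x - y by ring]
  ring

lemma GG_nonpos {ρ σ : ℝ} (hσ : 0 < σ) (h : σ ≤ ρ) {x : ℝ} (hx : 0 ≤ x) : GG ρ σ x ≤ 0 := by
  have hρ : 0 < ρ := hσ.trans_le h
  have hneg := GG_neg ρ σ x
  have h1 : GG ρ σ x - GG ρ σ (-x) =
      ∫ y, (hatKernel ρ (x - y) - hatKernel ρ (-x - y)) * h0 ρ σ y := by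
    unfold GG conv
    rw [← integral_sub (conv_int hρ (h0_int hσ h) x) (conv_int hρ (h0_int hσ h) (-x))]
    congr 1; ext y; ring
  have h2 : ∫ y, (hatKernel ρ (x - y) - hatKernel ρ (-x - y)) * h0 ρ σ y ≤ 0 := by
    apply integral_nonpos
    intro y
    simp only [Pi.zero_apply]
    rcases le_total 0 y with hy | hy
    · apply mul_nonpos_of_nonneg_of_nonpos _ (h0_nonpos hσ h hy)
      rw [sub_nonneg]
      apply hat_anti hρ
      rw [← sq_le_sq]
      nlinarith [mul_nonneg hx hy]
    · apply mul_nonpos_of_nonpos_of_nonneg _ (h0_nonneg hσ h hy)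
      rw [sub_nonpos]
      apply hat_anti hρ
      rw [← sq_le_sq]
      nlinarith [mul_nonneg hx (neg_nonneg.2 hy)]
  linarith

lemma GG_nonneg {ρ σ : ℝ} (hσ : 0 < σ) (h : σ ≤ ρ) {x : ℝ} (hx : x ≤ 0) : 0 ≤ GG ρ σ x := by
  have := GG_nonpos hσ h (x := -x) (by linarith)
  rw [GG_neg] at this; linarith

lemma GG_zero {ρ σ : ℝ} (hσ : 0 < σ) (h : σ ≤ ρ) {x : ℝ} (hx : 2 * ρ ≤ |x|) : GG ρ σ x = 0 := by
  unfold GG conv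
  rw [← integral_zero ℝ ℝ (μ := volume)]
  congr 1; ext y
  rcases le_total ρ |y| with hy | hy
  · rw [h0_zero hσ h hy, mul_zero]
  · rw [hat_zero, zero_mul]
    have := abs_sub_abs_le_abs_sub x y
    linarith

lemma conv_translate (ρ t : ℝ) (f : ℝ → ℝ) (x : ℝ) :
    conv (hatKernel ρ) (fun y => f (y - t)) x = conv (hatKernel ρ) f (x - t) := by
  unfold conv
  rw [← integral_sub_right_eq_self (fun y => hatKernel ρ (x - t - y) * f y) t]
  congr 1; ext y
  rw [show x - t - (y - t) = x - y by ring]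

/-! ### The fidelity term -/

/-- residual -/
def DD (ρ σ : ℝ) (Z B : BarcodeRep) (x : ℝ) : ℝ :=
  conv (hatKernel ρ) B.fn x - conv (hatKernel σ) Z.fn x

lemma cont_conv_fn {ρ : ℝ} (hρ : 0 < ρ) (B : BarcodeRep) : Continuous (conv (hatKernel ρ) B.fn) :=
  conv_continuous hρ B.fn_int

lemma comp_conv_fn (ρ : ℝ) (B : BarcodeRep) : HasCompactSupport (conv (hatKernel ρ) B.fn) :=
  conv_compact ρ B.fn_compact

lemma DD_continuous {ρ σ : ℝ} (hρ : 0 < ρ) (hσ : 0 < σ) (Z B : BarcodeRep) :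
    Continuous (DD ρ σ Z B) :=
  (cont_conv_fn hρ B).sub (cont_conv_fn hσ Z)

lemma DD_compact (ρ σ : ℝ) (Z B : BarcodeRep) : HasCompactSupport (DD ρ σ Z B) :=
  (comp_conv_fn ρ B).sub (comp_conv_fn σ Z)

lemma int_mul {f g : ℝ → ℝ} (hf : Continuous f) (hg : Continuous g) (h : HasCompactSupport f) :
    Integrable (fun x => f x * g x) :=
  (hf.mul hg).integrable_of_hasCompactSupport h.mul_right

/-- real-valued fidelity -/
def fidR (ρ σ : ℝ) (Z B : BarcodeRep) : ℝ := ∫ x, DD ρ σ Z B x * DD ρ σ Z B x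

lemma DD_int {ρ σ : ℝ} (hρ : 0 < ρ) (hσ : 0 < σ) (Z B : BarcodeRep) :
    Integrable (fun x => DD ρ σ Z B x * DD ρ σ Z B x) :=
  int_mul (DD_continuous hρ hσ Z B) (DD_continuous hρ hσ Z B) (DD_compact ρ σ Z B)

lemma fidelity_eq {ρ σ : ℝ} (hρ : 0 < ρ) (hσ : 0 < σ) (Z B : BarcodeRep) :
    fidelity (conv (hatKernel ρ) B.fn) (conv (hatKernel σ) Z.fn) =
      ENNReal.ofReal (fidR ρ σ Z B) := by
  unfold fidelity fidR
  rw [ofReal_integral_eq_lintegral_ofReal (DD_int hρ hσ Z B)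
    (Filter.Eventually.of_forall fun x => mul_self_nonneg _)]
  simp only [DD, sq]

lemma fidR_nonneg (ρ σ : ℝ) (Z B : BarcodeRep) : 0 ≤ fidR ρ σ Z B :=
  integral_nonneg fun _ => mul_self_nonneg _

lemma Fker_eq {ρ σ lam : ℝ} (hρ : 0 < ρ) (hσ : 0 < σ) (hl : 0 < lam) (Z B : BarcodeRep) :
    Fker lam (hatKernel ρ) (conv (hatKernel σ) Z.fn) B.fn =
      ENNReal.ofReal (2 * B.n + lam * fidR ρ σ Z B) := by
  unfold Fker
  rw [fidelity_eq hρ hσ, B.TV_eq, ← ENNReal.ofReal_mul hl.le, ENNReal.ofReal_add (by positivity)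
    (mul_nonneg hl.le (fidR_nonneg _ _ _ _))]
  congr 1
  rw [← ENNReal.ofReal_natCast]
  push_cast
  rfl

lemma conv_fn_le_one {ρ : ℝ} (hρ : 0 < ρ) {f : ℝ → ℝ} (hf : Integrable f)
    (h : f ≤ᵐ[volume] (Icc (0:ℝ) 1).indicator fun _ => (1:ℝ)) (x : ℝ) :
    conv (hatKernel ρ) f x ≤ 1 := by
  refine (conv_mono hρ hf (int_Icc 0 1) h x).trans ?_
  rw [conv_Icc hρ zero_le_one]
  linarith [Psi_le hρ (x - 0), Psi_ge hρ (x - 1)]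

lemma BarcodeRep.fn_le_ind (B : BarcodeRep) (x : ℝ) :
    B.fn x ≤ (Icc (0:ℝ) 1).indicator (fun _ => (1:ℝ)) x := by
  by_cases h : x ∈ Icc (0:ℝ) 1
  · simp only [h, Set.indicator_of_mem]; exact B.fn_le_one x
  · rw [BarcodeRep.fn_zero_of_not_mem h]; simp [h]

/-- flipping `U` to the values of `Z` on a bar or space of `Z` -/
lemma flip_step {ρ σ ω : ℝ} (hσ : 0 < σ) (hσρ : σ ≤ ρ) (hρω : ρ ≤ ω / 2) {Z : BarcodeRep}
    (hZ : Z.MinWidth ω) (U : BarcodeRep) {k : ℕ} (hk : k + 1 < 2 * Z.n)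
    (hU : ∀ x, Z.t k < x → x < Z.t (k + 1) → U.fn x = if Even k then 0 else 1) :
    ∃ V : BarcodeRep, V.n ≤ U.n + 1 ∧ fidR ρ σ Z V ≤ fidR ρ σ Z U +
      (-ω + 1 / (15 * ρ ^ 2) * (-σ ^ 3 + 5 * ρ * σ ^ 2 + 17 * ρ ^ 3)) := by
  have hρ : 0 < ρ := hσ.trans_le hσρ
  have hgap := BarcodeRep.gap_ge hZ hk
  have hlt := BarcodeRep.lt_of (Nat.lt_succ_self k) hk
  have hZk : ∀ x, Z.t k < x → x < Z.t (k + 1) → Z.fn x = if Even k then 1 else 0 :=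
    fun x h1 h2 => BarcodeRep.fn_gap hk h1 h2
  have ha := (BarcodeRep.t_mem (B := Z) (k := k) (by omega)).1
  have hb := (BarcodeRep.t_mem (B := Z) (k := k + 1) (by omega)).2
  simp only [Nat.succ_eq_add_one] at hlt
  generalize Z.t k = a at *
  generalize Z.t (k + 1) = b at *
  obtain ⟨V, hVn, hV⟩ := U.exists_flip ha hlt hb
  refine ⟨V, hVn, ?_⟩
  set χ : ℝ → ℝ := (Icc a b).indicator fun _ => (1:ℝ) with hχ
  have hχi : Integrable χ := int_Icc a b
  set P := conv (hatKernel ρ) χ with hP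
  set Q := conv (hatKernel σ) χ with hQ
  have hPe : ∀ x, P x = Psi ρ (x - a) - Psi ρ (x - b) := conv_Icc hρ hlt.le
  have hQe : ∀ x, Q x = Psi σ (x - a) - Psi σ (x - b) := conv_Icc hσ hlt.le
  have hχ0 : ∀ x, 0 ≤ χ x := fun x => Set.indicator_nonneg (fun _ _ => zero_le_one) x
  have hP0 : ∀ x, 0 ≤ P x := conv_nonneg hρ hχ0
  have hPc : Continuous P := conv_continuous hρ hχi
  have hQc : Continuous Q := conv_continuous hσ hχi
  have hPs : HasCompactSupport P := conv_compact ρ (compact_Icc a b)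
  have hne : ∀ᵐ x : ℝ, x ∉ ({a, b} : Finset ℝ) := ae_notMem _
  have hio : ∀ x, x ∉ ({a, b} : Finset ℝ) → x ∈ Icc a b → a < x ∧ x < b := by
    intro x h1 h2
    simp only [Finset.mem_insert, Finset.mem_singleton, not_or] at h1
    exact ⟨lt_of_le_of_ne h2.1 (Ne.symm h1.1), lt_of_le_of_ne h2.2 h1.2⟩
  have hVle : ∀ x, conv (hatKernel ρ) V.fn x ≤ 1 := fun x =>
    conv_fn_le_one hρ V.fn_int (Filter.Eventually.of_forall V.fn_le_ind) x
  have key : ∀ x, DD ρ σ Z V x * DD ρ σ Z V x ≤ DD ρ σ Z U x * DD ρ σ Z U x +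
      (2 * P x - P x ^ 2 - 2 * P x * Q x) := by
    by_cases he : Even k
    · simp only [he, if_true] at hU hZk
      have hVU : V.fn =ᵐ[volume] fun x => U.fn x + χ x := by
        filter_upwards [hV, hne] with x h1 h2
        rw [h1]
        by_cases hx : x ∈ Icc a b
        · have := hio x h2 hx
          simp [hχ, hx, hU x this.1 this.2]
        · simp [hχ, hx]
      have hVc : ∀ x, conv (hatKernel ρ) V.fn x = conv (hatKernel ρ) U.fn x + P x := by
        intro x
        rw [conv_congr ρ hVU, conv_add hρ U.fn_int hχi]
      have hZQ : ∀ x, Q x ≤ conv (hatKernel σ) Z.fn x := by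
        apply conv_mono hσ hχi Z.fn_int
        filter_upwards [hne] with x h2
        by_cases hx : x ∈ Icc a b
        · have := hio x h2 hx
          simp [hχ, hx, hZk x this.1 this.2]
        · simp only [hχ, hx, not_false_eq_true, Set.indicator_of_notMem]; exact Z.fn_nonneg x
      intro x
      have h1 := hVle x
      have h2 := hZQ x
      have h3 := hP0 x
      unfold DD
      rw [hVc] at *
      nlinarith [mul_nonneg h3 (sub_nonneg.2 h1), mul_nonneg h3 (sub_nonneg.2 h2)]
    · simp only [he, if_false] at hU hZk
      have hVU : U.fn =ᵐ[volume] fun x => V.fn x + χ x := by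
        filter_upwards [hV, hne] with x h1 h2
        rw [h1]
        by_cases hx : x ∈ Icc a b
        · have := hio x h2 hx
          simp [hχ, hx, hU x this.1 this.2]
        · simp [hχ, hx]
      have hVc : ∀ x, conv (hatKernel ρ) U.fn x = conv (hatKernel ρ) V.fn x + P x := by
        intro x
        rw [conv_congr ρ hVU, conv_add hρ V.fn_int hχi]
      have hV0 : ∀ x, 0 ≤ conv (hatKernel ρ) V.fn x := conv_nonneg hρ V.fn_nonneg
      have hZQ : ∀ x, conv (hatKernel σ) Z.fn x + Q x ≤ 1 := by
        intro x
        rw [← conv_add hσ Z.fn_int hχi]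
        apply conv_fn_le_one hσ (Z.fn_int.add hχi)
        filter_upwards [hne] with y h2
        by_cases hx : y ∈ Icc a b
        · have := hio y h2 hx
          have hy : y ∈ Icc (0:ℝ) 1 := ⟨by linarith, by linarith⟩
          rw [Set.indicator_of_mem hy]
          simp [hχ, hx, hZk y this.1 this.2]
        · have h0 : χ y = 0 := by simp [hχ, hx]
          show Z.fn y + χ y ≤ _
          rw [h0, add_zero]
          exact Z.fn_le_ind y
      intro x
      have h1 := hV0 x
      have h2 := hZQ x
      have h3 := hP0 x
      unfold DD
      rw [hVc]
      nlinarith [mul_nonneg h3 h1, mul_nonneg h3 (sub_nonneg.2 h2)]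
  have hTi : Integrable (fun x => 2 * P x - P x ^ 2 - 2 * P x * Q x) := by
    have : (fun x => 2 * P x - P x ^ 2 - 2 * P x * Q x) = fun x => P x * (2 - P x - 2 * Q x) := by
      ext x; ring
    rw [this]
    exact int_mul hPc (by fun_prop) hPs
  have hT : ∫ x, (2 * P x - P x ^ 2 - 2 * P x * Q x) =
      -(b - a) + 1 / (15 * ρ ^ 2) * (-σ ^ 3 + 5 * ρ * σ ^ 2 + 17 * ρ ^ 3) := by
    rw [← flip_integral hσ hσρ (by linarith)]
    simp_rw [hPe, hQe]
  have := integral_mono (DD_int hρ hσ Z V) ((DD_int hρ hσ Z U).add hTi) key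
  simp only [Pi.add_apply] at this
  rw [integral_add (DD_int hρ hσ Z U) hTi, hT] at this
  unfold fidR
  linarith

/-! ### Comparison with `z` -/

lemma cross_nonneg {ρ σ ω : ℝ} (hσ : 0 < σ) (hσρ : σ ≤ ρ) (hρω : ρ ≤ ω / 2) {Z : BarcodeRep}
    (hZ : Z.MinWidth ω) (U : BarcodeRep) :
    0 ≤ ∫ x, conv (hatKernel ρ) (fun y => U.fn y - Z.fn y) x * DD ρ σ Z Z x := by
  have hρ : 0 < ρ := hσ.trans_le hσρ
  have hDi : Integrable (DD ρ σ Z Z) :=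
    (DD_continuous hρ hσ Z Z).integrable_of_hasCompactSupport (DD_compact ρ σ Z Z)
  rw [conv_symm (f := fun y => U.fn y - Z.fn y) hρ (U.fn_int.sub Z.fn_int) hDi]
  have hD : DD ρ σ Z Z = fun x => ∑ k ∈ Finset.range (2 * Z.n), (-1) ^ k * h0 ρ σ (x - Z.t k) := by
    ext x
    unfold DD h0
    rw [BarcodeRep.conv_fn hρ, BarcodeRep.conv_fn hσ, ← Finset.sum_sub_distrib]
    apply Finset.sum_congr rfl
    intro k _; ring
  have hG : ∀ x, conv (hatKernel ρ) (DD ρ σ Z Z) x =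
      ∑ k ∈ Finset.range (2 * Z.n), (-1) ^ k * GG ρ σ (x - Z.t k) := by
    intro x
    rw [hD, conv_sum hρ]
    · apply Finset.sum_congr rfl
      intro k _
      rw [conv_const_mul, conv_translate, GG]
    · intro k _
      exact ((h0_int hσ hσρ).comp_sub_right (Z.t k)).const_mul _
  apply integral_nonneg_of_ae
  filter_upwards [ae_notMem Z.ifc] with x hx
  simp only [Pi.zero_apply]
  rw [hG, Finset.mul_sum]
  apply Finset.sum_nonneg
  intro k hk
  have hk' : k < 2 * Z.n := by simpa using hk
  have hne : Z.t k ≠ x := fun h => hx (BarcodeRep.mem_ifc.2 ⟨k, hk', h⟩)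
  have hu0 := U.fn_nonneg x
  have hu1 := U.fn_le_one x
  rcases le_or_gt (2 * ρ) |x - Z.t k| with hfar | hnear
  · rw [GG_zero hσ hσρ hfar]; simp
  · rw [abs_lt] at hnear
    rcases lt_or_gt_of_ne hne with h1 | h1
    · have hz := BarcodeRep.fn_near_right hZ hk' h1 (by linarith)
      have hg := GG_nonpos hσ hσρ (x := x - Z.t k) (by linarith)
      rw [hz]
      rcases Nat.even_or_odd k with he | he
      · rw [if_pos he, he.neg_one_pow, one_mul]
        exact mul_nonneg_of_nonpos_of_nonpos (by linarith) hg
      · rw [if_neg (Nat.not_even_iff_odd.2 he), he.neg_one_pow]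
        exact mul_nonneg (by linarith) (by linarith)
    · have hz := BarcodeRep.fn_near_left hZ hk' h1 (by linarith)
      have hg := GG_nonneg hσ hσρ (x := x - Z.t k) (by linarith)
      rw [hz]
      rcases Nat.even_or_odd k with he | he
      · rw [if_pos he, he.neg_one_pow, one_mul]
        exact mul_nonneg (by linarith) hg
      · rw [if_neg (Nat.not_even_iff_odd.2 he), he.neg_one_pow]
        exact mul_nonneg_of_nonpos_of_nonpos (by linarith) (by linarith)

/-- a difference of bar codes with different interfaces is not annihilated by the hat kernel -/
lemma conv_ne_zero {ρ : ℝ} (hρ : 0 < ρ) {U Z : BarcodeRep} (hne : U.ifc ≠ Z.ifc) :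
    ∃ x, conv (hatKernel ρ) (fun y => U.fn y - Z.fn y) x ≠ 0 := by
  have hS : (symmDiff U.ifc Z.ifc).Nonempty := by
    rw [Finset.nonempty_iff_ne_empty]
    intro h
    exact hne (symmDiff_eq_bot.1 h)
  set S := symmDiff U.ifc Z.ifc with hSdef
  set s := S.min' hS with hs
  have hsS : s ∈ S := S.min'_mem hS
  have hmin : ∀ r ∈ S, s ≤ r := fun r hr => S.min'_le r hr
  -- a small interval to the right of `s` without interfaces
  obtain ⟨ε, hε, hερ, hfree⟩ : ∃ ε > 0, ε ≤ ρ ∧ ∀ r ∈ U.ifc ∪ Z.ifc, s < r → s + ε < r := by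
    classical
    let R := (insert (s + 2 * ρ) ((U.ifc ∪ Z.ifc).filter (fun r => s < r)))
    have hR : R.Nonempty := ⟨s + 2 * ρ, by simp [R]⟩
    have hm := R.min'_mem hR
    have hpos : s < R.min' hR := by
      rw [Finset.mem_insert] at hm
      rcases hm with h | h
      · rw [h]; linarith
      · exact (Finset.mem_filter.1 h).2
    have hle : R.min' hR ≤ s + 2 * ρ := R.min'_le _ (by simp [R])
    refine ⟨(R.min' hR - s) / 2, by linarith, by linarith, ?_⟩
    intro r hr hsr
    have : R.min' hR ≤ r := R.min'_le _ (Finset.mem_insert_of_mem (Finset.mem_filter.2 ⟨hr, hsr⟩))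
    linarith
  have hconst : ∀ T : Finset ℝ, T ⊆ U.ifc ∪ Z.ifc → ∀ x, s ≤ x → x ≤ s + ε →
      sgnS T x = sgnS T s := by
    intro T hT x h1 h2
    unfold sgnS
    apply Finset.prod_congr rfl
    intro r hr
    have : r ≤ x ↔ r ≤ s := by
      constructor
      · intro h
        by_contra h'
        have := hfree r (hT hr) (not_le.1 h')
        linarith
      · intro h; linarith
    simp only [this]
  have hleft : ∀ x, x < s → sgnS S x = 1 := by
    intro x hx
    apply Finset.prod_eq_one
    intro r hr
    have := hmin r hr
    rw [if_neg (by linarith)]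
  have hat_s : sgnS S s = -1 := by
    unfold sgnS
    rw [Finset.prod_eq_single s]
    · simp
    · intro r hr hrs
      have := lt_of_le_of_ne (hmin r hr) (Ne.symm hrs)
      rw [if_neg (by linarith)]
    · intro h; exact absurd hsS h
  set c : ℝ := (sgnS Z.ifc s - sgnS U.ifc s) / 2 with hc
  have hc0 : c ≠ 0 := by
    rw [hSdef, sgnS_symmDiff] at hat_s
    intro h
    have : sgnS Z.ifc s = sgnS U.ifc s := by linarith
    rw [this, sgnS_sq] at hat_s
    norm_num at hat_s
  refine ⟨s - ρ + ε, ?_⟩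
  have hconv : conv (hatKernel ρ) (fun y => U.fn y - Z.fn y) (s - ρ + ε) =
      conv (hatKernel ρ) (fun y => c * (Icc s (s + ε)).indicator (fun _ => (1:ℝ)) y)
        (s - ρ + ε) := by
    unfold conv
    apply integral_congr_ae
    filter_upwards [ae_notMem U.ifc, ae_notMem Z.ifc] with y h1 h2
    rw [BarcodeRep.fn_eq_sgn h1, BarcodeRep.fn_eq_sgn h2]
    rcases lt_or_ge y s with hy | hy
    · have h3 := hleft y hy
      rw [hSdef, sgnS_symmDiff] at h3
      have h4 : y ∉ Icc s (s + ε) := fun h => by linarith [h.1]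
      have h5 : sgnS U.ifc y = sgnS Z.ifc y := by
        have := sgnS_sq Z.ifc y
        rcases sgnS_cases Z.ifc y with h | h <;> rw [h] at h3 ⊢ <;> linarith
      rw [Set.indicator_of_notMem h4, h5]
      ring
    · rcases le_or_gt y (s + ε) with hy2 | hy2
      · rw [Set.indicator_of_mem (show y ∈ Icc s (s + ε) from ⟨hy, hy2⟩),
          hconst U.ifc Finset.subset_union_left y hy hy2,
          hconst Z.ifc Finset.subset_union_right y hy hy2, hc]
        ring
      · rw [hat_zero, zero_mul, zero_mul]
        rw [show s - ρ + ε - y = -(y - (s - ρ + ε)) by ring, abs_neg]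
        exact le_trans (by linarith) (le_abs_self _)
  rw [hconv, conv_const_mul, conv_Icc hρ (by linarith)]
  apply mul_ne_zero hc0
  rw [show s - ρ + ε - s = -(ρ - ε) by ring, show s - ρ + ε - (s + ε) = -ρ by ring, Psi_neg,
    Psi_neg, Psi_hi hρ le_rfl, Psi_mid hρ (by linarith) (by linarith)]
  have : -((ρ - ε) / ρ - (ρ - ε) ^ 2 / (2 * ρ ^ 2)) - -(1 / 2) = ε ^ 2 / (2 * ρ ^ 2) := by
    field_simp
    ring
  rw [this]
  positivity

lemma fid_lt {ρ σ ω : ℝ} (hσ : 0 < σ) (hσρ : σ ≤ ρ) (hρω : ρ ≤ ω / 2) {Z : BarcodeRep}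
    (hZ : Z.MinWidth ω) {U : BarcodeRep} (hne : U.ifc ≠ Z.ifc) :
    fidR ρ σ Z Z < fidR ρ σ Z U := by
  have hρ : 0 < ρ := hσ.trans_le hσρ
  have hcross := cross_nonneg hσ hσρ hρω hZ U
  obtain ⟨x₀, hx₀⟩ := conv_ne_zero hρ hne
  set w := conv (hatKernel ρ) (fun y => U.fn y - Z.fn y) with hw
  have hwe : ∀ x, w x = conv (hatKernel ρ) U.fn x - conv (hatKernel ρ) Z.fn x :=
    fun x => conv_sub hρ U.fn_int Z.fn_int x
  have hwc : Continuous w := conv_continuous hρ (U.fn_int.sub Z.fn_int)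
  have hws : HasCompactSupport w := conv_compact ρ (U.fn_compact.sub Z.fn_compact)
  have hpos : 0 < ∫ x, w x * w x :=
    (hwc.mul hwc).integral_pos_of_hasCompactSupport_nonneg_nonzero hws.mul_right
      (fun x => mul_self_nonneg _) (x := x₀) (mul_self_ne_zero.2 hx₀)
  have i1 : Integrable (fun x => w x * w x) := int_mul hwc hwc hws
  have i2 : Integrable (fun x => 2 * (w x * DD ρ σ Z Z x)) :=
    (int_mul hwc (DD_continuous hρ hσ Z Z) hws).const_mul 2
  have i3 := DD_int hρ hσ Z Z
  have i12 : Integrable (fun x => w x * w x + 2 * (w x * DD ρ σ Z Z x)) := i1.add i2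
  have : fidR ρ σ Z U = fidR ρ σ Z Z + ((∫ x, w x * w x) + 2 * ∫ x, w x * DD ρ σ Z Z x) := by
    unfold fidR
    rw [← integral_const_mul, ← integral_add i1 i2, ← integral_add i3 i12]
    congr 1; ext x
    have : DD ρ σ Z U x = DD ρ σ Z Z x + w x := by
      rw [hwe]; unfold DD; ring
    rw [this]
    ring
  rw [this]
  linarith

/-- Lemma 11, consequence: for hat kernels with
`0 < σ ≤ ρ ≤ ω/2`, `z ∈ ℬ_ω` and `2/λ + (1/(15ρ²))(−σ³ + 5ρσ² + 17ρ³) < ω`,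
every interface location of a minimiser `u` of `F₃` over `ℬ` is an interface
location of `z`. -/
theorem statement17 (σ ρ ω lam : ℝ) (hσ : 0 < σ) (hσρ : σ ≤ ρ) (hρω : ρ ≤ ω / 2)
    (hω : 0 < ω) (Z : BarcodeRep) (hZ : Z.MinWidth ω) (hlam : 0 < lam)
    (hcond : 2 / lam + 1 / (15 * ρ^2) * (-σ^3 + 5 * ρ * σ^2 + 17 * ρ^3) < ω)
    (U : BarcodeRep)
    (hmin : ∀ v : ℝ → ℝ, IsBarcode v →
      Fker lam (hatKernel ρ) (conv (hatKernel σ) Z.fn) U.fn ≤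
        Fker lam (hatKernel ρ) (conv (hatKernel σ) Z.fn) v) :
    ∀ x : ℝ, U.IsInterface x → Z.IsInterface x := by
  have hρ : 0 < ρ := hσ.trans_le hσρ
  have hR : ∀ B : BarcodeRep, 2 * (U.n : ℝ) + lam * fidR ρ σ Z U ≤
      2 * (B.n : ℝ) + lam * fidR ρ σ Z B := by
    intro B
    have h := hmin B.fn ⟨B, rfl⟩
    rw [Fker_eq hρ hσ hlam, Fker_eq hρ hσ hlam, ENNReal.ofReal_le_ofReal_iff] at h
    · exact h
    · have := mul_nonneg hlam.le (fidR_nonneg ρ σ Z B)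
      positivity
  have hTV : ((2 * Z.n : ℕ) : ENNReal) ≤ TV U.fn := by
    apply BarcodeRep.le_TV Z _ (fun x hx => BarcodeRep.fn_zero_of_not_mem hx)
    intro k hk
    by_contra hcon
    push Not at hcon
    obtain ⟨V, hVn, hV⟩ := flip_step hσ hσρ hρω hZ U hk (by
      intro x h1 h2
      have h3 := hcon x h1 h2
      by_cases he : Even k
      · simp only [he, if_true] at h3 ⊢
        exact (U.fn_cases x).resolve_right h3
      · simp only [he, if_false] at h3 ⊢
        exact (U.fn_cases x).resolve_left h3)
    have h1 := hR V
    have h2 : (V.n : ℝ) ≤ U.n + 1 := by exact_mod_cast hVn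
    have h3 := mul_le_mul_of_nonneg_left hV hlam.le
    have h4 := mul_lt_mul_of_pos_left hcond hlam
    have h5 : lam * (2 / lam) = 2 := by field_simp
    rw [mul_add, h5] at h4
    rw [mul_add, mul_add] at h3
    linarith
  rw [U.TV_eq] at hTV
  have hn : (Z.n : ℝ) ≤ U.n := by
    have : 2 * Z.n ≤ 2 * U.n := by exact_mod_cast hTV
    exact_mod_cast (by omega : Z.n ≤ U.n)
  have hifc : U.ifc = Z.ifc := by
    by_contra hne
    have h1 := fid_lt hσ hσρ hρω hZ hne
    have h2 := hR Z
    have h3 := mul_lt_mul_of_pos_left h1 hlam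
    linarith
  intro x hx
  rw [← BarcodeRep.mem_ifc, hifc, BarcodeRep.mem_ifc] at hx
  exact hx

end
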